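/- Let H ⊂ S^n be a closed hemisphere with center o, let B ⊆ H be a spherical ball of radius ≤ π/2 centered at o, and let T ⊆ H be a set star-shaped with respect to o (i.e., for every x ∈ T the geodesic segment from o to x lies in T). Then σ(B ∩ T) · σ(H) ≥ σ(B) · σ(T), where σ is the standard rotation-invariant measure on S^n. -/

import Mathlib

open MeasureTheory RealInnerProductSpace

/-- Geodesic distance between two points of the unit sphere in Euclidean space. -/
noncomputable def geodist {n : ℕ} (x y : EuclideanSpace ℝ (Fin n)) : ℝ :=
  Real.arccos ⟪x, y⟫


/-- One-dimensional inequality on a single meridian. -/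
lemma sc_oned (lam : Measure ℝ) (c : ℝ) (hc0 : 0 ≤ c) (P : Set ℝ) :
    lam {h | 0 ≤ h ∧ h ≤ 1 ∧ lam {h' | h ≤ h' ∧ c ≤ h' ∧ h' ≤ 1 ∧ h' ∉ P} = 0} * lam (Set.Icc c 1)
      ≤ lam (Set.Icc c 1 ∩ P) * lam (Set.Icc 0 1) := by
  set J := {h | 0 ≤ h ∧ h ≤ 1 ∧ lam {h' | h ≤ h' ∧ c ≤ h' ∧ h' ≤ 1 ∧ h' ∉ P} = 0} with hJ
  have hJ1 : J ⊆ Set.Icc 0 1 := fun h hh => ⟨hh.1, hh.2.1⟩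
  have key : ∀ A ⊆ Set.Icc c 1, lam {h' | h' ∈ A ∧ h' ∉ P} = 0 →
      lam A ≤ lam (Set.Icc c 1 ∩ P) := by
    intro A hA h0
    calc lam A ≤ lam ((Set.Icc c 1 ∩ P) ∪ {h' | h' ∈ A ∧ h' ∉ P}) := by
          apply measure_mono
          intro x hx
          by_cases hp : x ∈ P
          · exact Or.inl ⟨hA hx, hp⟩
          · exact Or.inr ⟨hx, hp⟩
      _ ≤ lam (Set.Icc c 1 ∩ P) + lam {h' | h' ∈ A ∧ h' ∉ P} := measure_union_le _ _
      _ = _ := by rw [h0, add_zero]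
  by_cases hcJ : ∃ h ∈ J, h ≤ c
  · obtain ⟨h, hh, hc⟩ := hcJ
    rw [mul_comm]
    refine mul_le_mul' (key _ subset_rfl ?_) (measure_mono hJ1)
    refine measure_mono_null ?_ hh.2.2
    rintro x ⟨hx, hp⟩
    exact ⟨hc.trans hx.1, hx.1, hx.2, hp⟩
  · push Not at hcJ
    have hJc : J ⊆ Set.Icc c 1 := fun h hh => ⟨(hcJ h hh).le, hh.2.1⟩
    refine mul_le_mul' (key _ hJc ?_) (measure_mono (Set.Icc_subset_Icc_left hc0))
    apply measure_null_of_locally_null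
    rintro h ⟨hh, hp⟩
    by_cases hmin : ∃ h0 ∈ J, h0 < h
    · obtain ⟨h0, hh0, hlt⟩ := hmin
      refine ⟨Set.Ici h0 ∩ {h' | h' ∈ J ∧ h' ∉ P},
        Filter.inter_mem (mem_nhdsWithin_of_mem_nhds (Ici_mem_nhds hlt)) self_mem_nhdsWithin, measure_mono_null ?_ hh0.2.2⟩
      rintro x ⟨hx, hxJ, hxp⟩
      exact ⟨hx, (hJc hxJ).1, (hJc hxJ).2, hxp⟩
    · push Not at hmin
      refine ⟨_, self_mem_nhdsWithin, measure_mono_null ?_ hh.2.2⟩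
      rintro x ⟨hxJ, hxp⟩
      exact ⟨hmin x hxJ, (hJc hxJ).1, (hJc hxJ).2, hxp⟩

/-- Averaging over a compact group acting by isometries. -/
lemma sc_avg_aux {E : Type} [NormedAddCommGroup E] [InnerProductSpace ℝ E] [FiniteDimensional ℝ E]
    [MeasurableSpace E] [BorelSpace E] (o : E) (μ : Measure E) [IsFiniteMeasure μ]
    (hinv : ∀ u : E ≃ₗᵢ[ℝ] E, u o = o → ∀ S, MeasurableSet S → μ (u ⁻¹' S) = μ S)
    (γ : ℝ → E) (hγ : Continuous γ)
    (hμ : ∀ᵐ x ∂μ, ‖γ ⟪o, x⟫‖ = ‖x‖ ∧ ⟪o, γ ⟪o, x⟫⟫ = ⟪o, x⟫)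
    (G : Type) [Group G] [TopologicalSpace G] [IsTopologicalGroup G] [CompactSpace G]
    [SecondCountableTopology G] [MeasurableSpace G] [BorelSpace G]
    (A : G →* (E ≃ₗᵢ[ℝ] E)) (hA : Continuous (fun p : G × E => A p.1 p.2))
    (hAo : ∀ g, A g o = o) (hsurj : ∀ u : E ≃ₗᵢ[ℝ] E, u o = o → ∃ g, A g = u) :
    ∃ (Ω : Type) (_ : MeasurableSpace Ω) (κ : Measure Ω) (Φ : Ω → E ≃ₗᵢ[ℝ] E),
      (∀ ω, Φ ω o = o) ∧ ∀ S, MeasurableSet S →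
        μ S = ∫⁻ ω, μ.map (fun x => ⟪o, x⟫) {h | Φ ω (γ h) ∈ S} ∂κ := by
  let κ : Measure G := Measure.haarMeasure ⊤
  have hκ : κ Set.univ = 1 :=
    Measure.haarMeasure_self (K₀ := (⊤ : TopologicalSpace.PositiveCompacts G))
  have : IsProbabilityMeasure κ := ⟨hκ⟩
  let Φ : G → E ≃ₗᵢ[ℝ] E := fun g => A g⁻¹
  have hΦo : ∀ g, Φ g o = o := fun g => hAo g⁻¹
  have hΦc : Continuous (fun p : G × E => Φ p.1 p.2) :=
    hA.comp ((continuous_inv.comp continuous_fst).prodMk continuous_snd)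
  refine ⟨G, inferInstance, κ, Φ, hΦo, fun S hS => ?_⟩
  have hin : Measurable (fun x : E => ⟪o, x⟫) := by fun_prop
  have hS1 : MeasurableSet {p : G × E | Φ p.1 p.2 ∈ S} := hΦc.measurable hS
  have hS2 : MeasurableSet {p : G × ℝ | Φ p.1 (γ p.2) ∈ S} := by
    have : Continuous (fun p : G × ℝ => Φ p.1 (γ p.2)) :=
      hΦc.comp (continuous_fst.prodMk (hγ.comp continuous_snd))
    exact this.measurable hS
  have hmeas : Measurable fun h : ℝ => κ {g | Φ g (γ h) ∈ S} :=
    measurable_measure_prodMk_right hS2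
  calc μ S = ∫⁻ g, μ {x | Φ g x ∈ S} ∂κ := by
        have : ∀ g, μ {x | Φ g x ∈ S} = μ S := fun g => hinv (Φ g) (hΦo g) S hS
        simp [this]
    _ = (κ.prod μ) {p : G × E | Φ p.1 p.2 ∈ S} := (Measure.prod_apply hS1).symm
    _ = ∫⁻ x, κ {g | Φ g x ∈ S} ∂μ := Measure.prod_apply_symm hS1
    _ = ∫⁻ x, κ {g | Φ g (γ ⟪o, x⟫) ∈ S} ∂μ := by
        refine lintegral_congr_ae ?_
        filter_upwards [hμ] with x hx
        let r : E ≃ₗᵢ[ℝ] E := (ℝ ∙ (γ ⟪o, x⟫ - x))ᗮ.reflection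
        have hr : r (γ ⟪o, x⟫) = x := Submodule.reflection_sub hx.1
        have hro : r o = o := by
          apply Submodule.reflection_mem_subspace_eq_self
          rw [Submodule.mem_orthogonal_singleton_iff_inner_left, inner_sub_right, hx.2, sub_self]
        obtain ⟨s, hs⟩ := hsurj r hro
        have h1 : {g | Φ g x ∈ S} = (fun g => s⁻¹ * g) ⁻¹' {g | Φ g (γ ⟪o, x⟫) ∈ S} := by
          ext g
          have : Φ (s⁻¹ * g) (γ ⟪o, x⟫) = Φ g x := by
            simp only [Φ, mul_inv_rev, inv_inv, map_mul, hs, LinearIsometryEquiv.coe_mul,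
              Function.comp_apply, hr]
          simp only [Set.mem_ofPred_eq, Set.mem_preimage, this]
        rw [h1, measure_preimage_mul]
    _ = ∫⁻ h, κ {g | Φ g (γ h) ∈ S} ∂(μ.map (fun x => ⟪o, x⟫)) := by
        rw [lintegral_map hmeas hin]
    _ = (κ.prod (μ.map (fun x => ⟪o, x⟫))) {p : G × ℝ | Φ p.1 (γ p.2) ∈ S} :=
        (Measure.prod_apply_symm hS2).symm
    _ = _ := Measure.prod_apply hS2

/-- The stabilizer of `o` in the orthogonal group. -/
def scStab {E : Type} [NormedAddCommGroup E] [InnerProductSpace ℝ E] [CompleteSpace E]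
    (o : E) : Subgroup (unitary (E →L[ℝ] E)) where
  carrier := {u | Unitary.linearIsometryEquiv u o = o}
  mul_mem' := by
    intro a b ha hb
    simp only [Set.mem_ofPred_eq] at *
    rw [map_mul, LinearIsometryEquiv.coe_mul, Function.comp_apply, hb, ha]
  one_mem' := by simp
  inv_mem' := by
    intro a ha
    simp only [Set.mem_ofPred_eq] at *
    rw [map_inv]
    change (Unitary.linearIsometryEquiv a).symm o = o
    rw [LinearIsometryEquiv.symm_apply_eq, ha]

lemma sc_avg {E : Type} [NormedAddCommGroup E] [InnerProductSpace ℝ E] [FiniteDimensional ℝ E]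
    [MeasurableSpace E] [BorelSpace E] (o : E) (μ : Measure E) [IsFiniteMeasure μ]
    (hinv : ∀ u : E ≃ₗᵢ[ℝ] E, u o = o → ∀ S, MeasurableSet S → μ (u ⁻¹' S) = μ S)
    (γ : ℝ → E) (hγ : Continuous γ)
    (hμ : ∀ᵐ x ∂μ, ‖γ ⟪o, x⟫‖ = ‖x‖ ∧ ⟪o, γ ⟪o, x⟫⟫ = ⟪o, x⟫) :
    ∃ (Ω : Type) (_ : MeasurableSpace Ω) (κ : Measure Ω) (Φ : Ω → E ≃ₗᵢ[ℝ] E),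
      (∀ ω, Φ ω o = o) ∧ ∀ S, MeasurableSet S →
        μ S = ∫⁻ ω, μ.map (fun x => ⟪o, x⟫) {h | Φ ω (γ h) ∈ S} ∂κ := by
  have : CompleteSpace E := FiniteDimensional.complete ℝ E
  have hprop : ProperSpace (E →L[ℝ] E) := FiniteDimensional.proper_real _
  have hcU : IsCompact ((unitary (E →L[ℝ] E) : Set (E →L[ℝ] E))) := by
    refine Metric.isCompact_of_isClosed_isBounded isClosed_unitary ?_
    refine isBounded_iff_forall_norm_le.2 ⟨1, fun u hu => ?_⟩
    exact ContinuousLinearMap.opNorm_le_bound _ zero_le_one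
      (fun x => by rw [one_mul]; exact (Unitary.norm_map ⟨u, hu⟩ x).le)
  have : CompactSpace (unitary (E →L[ℝ] E)) := isCompact_iff_compactSpace.1 hcU
  have hev : Continuous (fun p : unitary (E →L[ℝ] E) × E => Unitary.linearIsometryEquiv p.1 p.2) := by
    have h1 : Continuous (fun p : unitary (E →L[ℝ] E) × E => (p.1 : E →L[ℝ] E)) :=
      continuous_subtype_val.comp continuous_fst
    exact h1.clm_apply continuous_snd
  have hGc : IsClosed (scStab o : Set (unitary (E →L[ℝ] E))) :=
    isClosed_eq (f := fun u : unitary (E →L[ℝ] E) => Unitary.linearIsometryEquiv u o)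
      (hev.comp (continuous_id.prodMk continuous_const)) continuous_const
  have : CompactSpace (scStab o) := isCompact_iff_compactSpace.1 hGc.isCompact
  let _ : MeasurableSpace (scStab o) := borel _
  have : BorelSpace (scStab o) := ⟨rfl⟩
  have : SecondCountableTopology (E →L[ℝ] E) := inferInstance
  have : SecondCountableTopology (unitary (E →L[ℝ] E)) :=
    Topology.IsInducing.subtypeVal.secondCountableTopology
  have : SecondCountableTopology (scStab o) :=
    Topology.IsInducing.subtypeVal.secondCountableTopology
  refine sc_avg_aux o μ hinv γ hγ hμ (scStab o)
    ((Unitary.linearIsometryEquiv (𝕜 := ℝ) (H := E)).toMonoidHom.comp (scStab o).subtype) ?_ ?_ ?_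
  · exact hev.comp ((continuous_subtype_val.comp continuous_fst).prodMk continuous_snd)
  · exact fun g => g.2
  · intro u hu
    refine ⟨⟨Unitary.linearIsometryEquiv.symm u, ?_⟩, ?_⟩
    · change Unitary.linearIsometryEquiv (Unitary.linearIsometryEquiv.symm u) o = o
      rw [MulEquiv.apply_symm_apply, hu]
    · exact MulEquiv.apply_symm_apply (Unitary.linearIsometryEquiv (𝕜 := ℝ) (H := E)) u

/-- The closed hemisphere has finite Hausdorff measure. -/
lemma sc_finite (n : ℕ) (o : EuclideanSpace ℝ (Fin (n + 1))) (ho : ‖o‖ = 1) :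
    μH[(n : ℝ)] {x : EuclideanSpace ℝ (Fin (n + 1)) | ‖x‖ = 1 ∧ 0 ≤ ⟪o, x⟫} < ⊤ := by
  have ho0 : o ≠ 0 := by rintro rfl; simp at ho
  have hoo : ⟪o, o⟫ = 1 := by rw [real_inner_self_eq_norm_sq, ho]; norm_num
  have hfr : Module.finrank ℝ (Fin n → ℝ) = Module.finrank ℝ (ℝ ∙ o)ᗮ := by
    have : Fact (Module.finrank ℝ (EuclideanSpace ℝ (Fin (n + 1))) = n + 1) := ⟨by simp⟩
    rw [Submodule.finrank_orthogonal_span_singleton (n := n) ho0]; simp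
  let L : (Fin n → ℝ) ≃L[ℝ] (ℝ ∙ o)ᗮ := ContinuousLinearEquiv.ofFinrankEq hfr
  let A : (Fin n → ℝ) →L[ℝ] EuclideanSpace ℝ (Fin (n + 1)) :=
    (ℝ ∙ o)ᗮ.subtypeL.comp (L : (Fin n → ℝ) →L[ℝ] (ℝ ∙ o)ᗮ)
  let F : (Fin n → ℝ) → EuclideanSpace ℝ (Fin (n + 1)) := fun v =>
    (1 + ‖A v‖ ^ 2)⁻¹ • ((2 : ℝ) • A v + (1 - ‖A v‖ ^ 2) • o)
  have hn : ContDiff ℝ 1 (fun v => ‖A v‖ ^ 2) := A.contDiff.norm_sq ℝ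
  have hF : ContDiff ℝ 1 F := by
    refine ContDiff.smul (ContDiff.inv (contDiff_const.add hn) fun v => by positivity) ?_
    have hA : ContDiff ℝ 1 (fun v => A v) := A.contDiff
    have h1 : ContDiff ℝ 1 (fun v => (2 : ℝ) • A v) := hA.const_smul 2
    have h2 : ContDiff ℝ 1 (fun v => (1 - ‖A v‖ ^ 2) • o) :=
      (contDiff_const.sub hn).smul contDiff_const
    exact h1.add h2
  let R : ℝ := ‖(L.symm : (ℝ ∙ o)ᗮ →L[ℝ] (Fin n → ℝ))‖
  obtain ⟨K, hK⟩ := hF.contDiffOn.exists_lipschitzOnWith one_ne_zero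
    (convex_closedBall (0 : Fin n → ℝ) R) (isCompact_closedBall 0 R)
  have hsub : {x : EuclideanSpace ℝ (Fin (n + 1)) | ‖x‖ = 1 ∧ 0 ≤ ⟪o, x⟫} ⊆
      F '' Metric.closedBall 0 R := by
    rintro x ⟨hx, hh⟩
    set h : ℝ := ⟪o, x⟫ with hhdef
    let w : EuclideanSpace ℝ (Fin (n + 1)) := (1 + h)⁻¹ • (x - h • o)
    have hxo : ⟪x, o⟫ = h := by rw [real_inner_comm]
    have hw : w ∈ (ℝ ∙ o)ᗮ := by
      rw [Submodule.mem_orthogonal_singleton_iff_inner_right]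
      simp only [w, inner_smul_right, inner_sub_right, hoo, ← hhdef]; ring
    have hw2 : ‖w‖ ^ 2 = (1 - h) / (1 + h) := by
      have h1 : ‖x - h • o‖ ^ 2 = 1 - h ^ 2 := by
        rw [norm_sub_sq_real, norm_smul, inner_smul_right, hxo, hx, ho, Real.norm_eq_abs, mul_one,
          sq_abs]; ring
      simp only [w]
      rw [norm_smul, mul_pow, h1, Real.norm_eq_abs, sq_abs]
      field_simp
      ring
    have hw1 : ‖w‖ ≤ 1 := by
      have : ‖w‖ ^ 2 ≤ 1 := by rw [hw2, div_le_one (by linarith)]; linarith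
      nlinarith [norm_nonneg w]
    refine ⟨L.symm ⟨w, hw⟩, ?_, ?_⟩
    · rw [mem_closedBall_zero_iff]
      calc _ ≤ R * ‖(⟨w, hw⟩ : (ℝ ∙ o)ᗮ)‖ :=
            (L.symm : (ℝ ∙ o)ᗮ →L[ℝ] (Fin n → ℝ)).le_opNorm _
        _ ≤ R * 1 := mul_le_mul_of_nonneg_left hw1 (by positivity)
        _ = R := mul_one _
    · have hA : A (L.symm ⟨w, hw⟩) = w := by simp [A]
      simp only [F, hA, hw2]
      simp only [w]
      have h1 : (1 + h) ≠ 0 := by linarith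
      have e1 : (1 + (1 - h) / (1 + h))⁻¹ = (1 + h) / 2 := by field_simp; ring
      have e2 : (1 - (1 - h) / (1 + h)) = 2 * h / (1 + h) := by field_simp; ring
      rw [e1, e2, smul_add, smul_smul, smul_smul, smul_smul]
      have e3 : (1 + h) / 2 * 2 * (1 + h)⁻¹ = 1 := by field_simp
      have e4 : (1 + h) / 2 * (2 * h / (1 + h)) = h := by field_simp
      rw [e3, e4]; simp
  refine (measure_mono hsub).trans_lt ((hK.hausdorffMeasure_image_le (Nat.cast_nonneg n)).trans_lt ?_)
  have : μH[(n : ℝ)] (Metric.closedBall (0 : Fin n → ℝ) R) < ⊤ := by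
    have h := hausdorffMeasure_pi_real (ι := Fin n)
    rw [Fintype.card_fin] at h
    rw [h]
    exact measure_closedBall_lt_top
  exact ENNReal.mul_lt_top (ENNReal.rpow_lt_top_of_nonneg (Nat.cast_nonneg n) ENNReal.coe_ne_top) this

/-- Norm of a point on a meridian. -/
lemma sc_norm {E : Type} [NormedAddCommGroup E] [InnerProductSpace ℝ E] (o v : E) (ho : ‖o‖ = 1)
    (hv : ‖v‖ = 1) (hov : ⟪o, v⟫ = 0) (a b : ℝ) : ‖a • o + b • v‖ ^ 2 = a ^ 2 + b ^ 2 := by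
  rw [norm_add_sq_real, norm_smul, norm_smul, inner_smul_left, inner_smul_right, hov, ho, hv,
    Real.norm_eq_abs, Real.norm_eq_abs, mul_one, mul_one, sq_abs, sq_abs]
  simp

/-- The point at height `h` on the meridian through `x`. -/
noncomputable def scPt {E : Type} [NormedAddCommGroup E] [InnerProductSpace ℝ E] (o : E)
    (h : ℝ) (x : E) : E :=
  h • o + √(1 - h ^ 2) • (‖x - ⟪o, x⟫ • o‖⁻¹ • (x - ⟪o, x⟫ • o))

lemma sc_core {E : Type} [NormedAddCommGroup E] [InnerProductSpace ℝ E] [FiniteDimensional ℝ E]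
    [MeasurableSpace E] [BorelSpace E] (o : E) (ho : ‖o‖ = 1) (e : E) (he : ‖e‖ = 1)
    (hoe : ⟪o, e⟫ = 0) (μ : Measure E) [IsFiniteMeasure μ]
    (hinv : ∀ u : E ≃ₗᵢ[ℝ] E, u o = o → ∀ S, MeasurableSet S → μ (u ⁻¹' S) = μ S)
    (hμ : ∀ᵐ x ∂μ, ‖x‖ = 1 ∧ 0 ≤ ⟪o, x⟫) (c : ℝ) (hc : 0 ≤ c) (T : Set E)
    (hT : ∀ x ∈ T, ‖x‖ = 1 ∧ 0 ≤ ⟪o, x⟫)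
    (hstar : ∀ x ∈ T, ∀ a b : ℝ, 0 ≤ a → 0 ≤ b → ‖a • o + b • x‖ = 1 → a • o + b • x ∈ T) :
    μ {x | ‖x‖ = 1 ∧ c ≤ ⟪o, x⟫} * μ T ≤ μ ({x | ‖x‖ = 1 ∧ c ≤ ⟪o, x⟫} ∩ T) * μ Set.univ := by
  have hoo : ⟪o, o⟫ = 1 := by rw [real_inner_self_eq_norm_sq, ho]; norm_num
  have hle1 : ∀ x : E, ‖x‖ = 1 → ⟪o, x⟫ ≤ 1 := fun x hx => by
    have := real_inner_le_norm o x
    rwa [ho, hx, one_mul] at this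
  have hd : ∀ x : E, ⟪o, x - ⟪o, x⟫ • o⟫ = 0 := fun x => by
    rw [inner_sub_right, inner_smul_right, hoo]; ring
  have hdn : ∀ x : E, ‖x‖ = 1 → ‖x - ⟪o, x⟫ • o‖ ^ 2 = 1 - ⟪o, x⟫ ^ 2 := fun x hx => by
    rw [norm_sub_sq_real, norm_smul, inner_smul_right, real_inner_comm, hx, ho, Real.norm_eq_abs,
      mul_one, sq_abs]
    ring
  set B : Set E := {x | ‖x‖ = 1 ∧ c ≤ ⟪o, x⟫} with hB
  have hin : Measurable (fun x : E => ⟪o, x⟫) := by fun_prop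
  have hBm : MeasurableSet B :=
    (measurableSet_eq_fun measurable_norm measurable_const).inter
      (measurableSet_le measurable_const hin)
  -- points of meridians of `T` are in `T`
  have hpt : ∀ x ∈ T, ∀ h, ⟪o, x⟫ ≤ h → h ≤ 1 → scPt o h x ∈ T ∧ ‖scPt o h x‖ = 1 ∧
      ⟪o, scPt o h x⟫ = h := by
    intro x hx h hh h1
    obtain ⟨hx1, hx0⟩ := hT x hx
    have hi : ⟪o, scPt o h x⟫ = h := by
      simp only [scPt, inner_add_right, inner_smul_right, hoo, hd]; ring
    have hN : ‖scPt o h x‖ = 1 := by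
      by_cases h0 : x - ⟪o, x⟫ • o = 0
      · have h2 := hdn x hx1
        rw [h0] at h2
        have : ⟪o, x⟫ = 1 := by
          simp at h2
          nlinarith [hle1 x hx1]
        have : h = 1 := le_antisymm h1 (this ▸ hh)
        subst this
        simp [scPt, ho]
      · have := sc_norm o (‖x - ⟪o, x⟫ • o‖⁻¹ • (x - ⟪o, x⟫ • o)) ho
          (by rw [norm_smul, norm_inv, norm_norm, inv_mul_cancel₀ (norm_ne_zero_iff.2 h0)])
          (by rw [inner_smul_right, hd, mul_zero]) h (√(1 - h ^ 2))
        rw [Real.sq_sqrt (by nlinarith)] at this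
        have h3 : ‖scPt o h x‖ ^ 2 = 1 := by rw [scPt, this]; ring
        nlinarith [norm_nonneg (scPt o h x)]
    refine ⟨?_, hN, hi⟩
    set s : ℝ := √(1 - h ^ 2) * ‖x - ⟪o, x⟫ • o‖⁻¹ with hs
    have hs0 : 0 ≤ s := by positivity
    have hs1 : s ≤ 1 := by
      rw [hs, ← div_eq_mul_inv]
      refine div_le_one_of_le₀ ?_ (norm_nonneg _)
      refine Real.sqrt_le_iff.2 ⟨norm_nonneg _, ?_⟩
      rw [hdn x hx1]; nlinarith
    have heq : scPt o h x = (h - s * ⟪o, x⟫) • o + s • x := by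
      simp only [scPt, hs]
      module
    rw [heq]
    refine hstar x hx _ _ ?_ hs0 (heq ▸ hN)
    nlinarith
  let γ : ℝ → E := fun h => h • o + √(1 - h ^ 2) • e
  have hγc : Continuous γ := by fun_prop
  have hγi : ∀ h, ⟪o, γ h⟫ = h := fun h => by
    simp only [γ, inner_add_right, inner_smul_right, hoo, hoe]; ring
  have hγn : ∀ h, ‖γ h‖ ^ 2 = h ^ 2 + √(1 - h ^ 2) ^ 2 := fun h => sc_norm o e ho he hoe _ _
  obtain ⟨Ω, _, κ, Φ, hΦo, hΦ⟩ := sc_avg o μ hinv γ hγc (by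
    filter_upwards [hμ] with x hx
    refine ⟨?_, hγi _⟩
    have := hγn ⟪o, x⟫
    rw [Real.sq_sqrt (by nlinarith [hle1 x hx.1])] at this
    rw [hx.1]
    nlinarith [norm_nonneg (γ ⟪o, x⟫)])
  set lam := μ.map (fun x => ⟪o, x⟫) with hlam
  have : IsFiniteMeasure lam := inferInstance
  set U := toMeasurable μ (B ∩ T) ∩ B with hU
  have hUm : MeasurableSet U := (measurableSet_toMeasurable _ _).inter hBm
  have hUμ : μ U ≤ μ (B ∩ T) := by
    rw [← measure_toMeasurable (μ := μ) (B ∩ T)]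
    exact measure_mono Set.inter_subset_left
  set V : Set E := {x | (‖x‖ = 1 ∧ 0 ≤ ⟪o, x⟫) ∧
    lam {h' | ⟪o, x⟫ ≤ h' ∧ c ≤ h' ∧ h' ≤ 1 ∧ scPt o h' x ∉ U} = 0} with hV
  have hptm : Measurable (fun p : E × ℝ => scPt o p.2 p.1) := by
    unfold scPt
    fun_prop
  have hVm : MeasurableSet V := by
    refine MeasurableSet.inter ((measurableSet_eq_fun measurable_norm measurable_const).inter
      (measurableSet_le measurable_const hin)) ?_
    have hm : MeasurableSet {p : E × ℝ | ⟪o, p.1⟫ ≤ p.2 ∧ c ≤ p.2 ∧ p.2 ≤ 1 ∧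
        scPt o p.2 p.1 ∉ U} :=
      (measurableSet_le (hin.comp measurable_fst) measurable_snd).inter
        ((measurableSet_le measurable_const measurable_snd).inter
          ((measurableSet_le measurable_snd measurable_const).inter (hptm hUm).compl))
    exact measurable_measure_prodMk_left (ν := lam) hm (measurableSet_singleton 0)
  have hTV : T ⊆ V := by
    intro x hx
    refine ⟨hT x hx, ?_⟩
    refine measure_mono_null (t := ∅) ?_ measure_empty
    rintro h ⟨h1, h2, h3, h4⟩
    obtain ⟨p1, p2, p3⟩ := hpt x hx h h1 h3
    have hpB : scPt o h x ∈ B := ⟨p2, by rw [p3]; exact h2⟩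
    exact h4 ⟨subset_toMeasurable _ _ ⟨hpB, p1⟩, hpB⟩
  have hsec : ∀ ω, lam {h | Φ ω (γ h) ∈ V} * lam (Set.Icc c 1) ≤
      lam {h | Φ ω (γ h) ∈ U} * lam (Set.Icc 0 1) := by
    intro ω
    have hi : ∀ h, ⟪o, Φ ω (γ h)⟫ = h := fun h => by
      conv_lhs => rw [← hΦo ω]
      rw [LinearIsometryEquiv.inner_map_map, hγi]
    refine le_trans (mul_le_mul' (measure_mono ?_) le_rfl)
      ((sc_oned lam c hc {h | Φ ω (γ h) ∈ U}).trans
        (mul_le_mul' (measure_mono Set.inter_subset_right) le_rfl))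
    rintro h ⟨⟨h1, h2⟩, h3⟩
    rw [hi] at h2
    have hle : h ≤ 1 := by
      have := hle1 _ h1
      rwa [hi] at this
    refine ⟨h2, hle, measure_mono_null ?_ h3⟩
    rintro h' ⟨g1, g2, g3, g4⟩
    refine ⟨by rw [hi]; exact g1, g2, g3, ?_⟩
    have : scPt o h' (Φ ω (γ h)) = Φ ω (γ h') := by
      have hdd : Φ ω (γ h) - h • o = √(1 - h ^ 2) • Φ ω e := by
        simp only [γ, map_add, map_smul, hΦo]; abel
      simp only [scPt, hi, hdd]
      simp only [γ, map_add, map_smul, hΦo]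
      congr 1
      rcases hle.lt_or_eq with hlt | rfl
      · have hpos : 0 < √(1 - h ^ 2) := Real.sqrt_pos.2 (by nlinarith)
        rw [norm_smul, LinearIsometryEquiv.norm_map, he, mul_one, Real.norm_of_nonneg hpos.le,
          smul_smul (√(1 - h ^ 2))⁻¹, inv_mul_cancel₀ hpos.ne', one_smul]
      · have : h' = 1 := le_antisymm g3 g1
        subst this
        simp
    rw [this]
    exact g4
  have hBl : μ B ≤ lam (Set.Icc c 1) := by
    rw [hlam, Measure.map_apply hin measurableSet_Icc]
    exact measure_mono fun x hx => ⟨hx.2, hle1 x hx.1⟩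
  have hHl : lam (Set.Icc 0 1) ≤ μ Set.univ := by
    rw [hlam, Measure.map_apply hin measurableSet_Icc]
    exact measure_mono (Set.subset_univ _)
  calc μ B * μ T ≤ lam (Set.Icc c 1) * μ V := mul_le_mul' hBl (measure_mono hTV)
    _ = ∫⁻ ω, lam {h | Φ ω (γ h) ∈ V} * lam (Set.Icc c 1) ∂κ := by
        rw [mul_comm, hΦ V hVm, lintegral_mul_const' _ _ (measure_ne_top _ _)]
    _ ≤ ∫⁻ ω, lam {h | Φ ω (γ h) ∈ U} * lam (Set.Icc 0 1) ∂κ := lintegral_mono hsec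
    _ = μ U * lam (Set.Icc 0 1) := by
        rw [hΦ U hUm, lintegral_mul_const' _ _ (measure_ne_top _ _)]
    _ ≤ _ := mul_le_mul' hUμ hHl

theorem spherical_correlation (n : ℕ)
    (o : EuclideanSpace ℝ (Fin (n + 1))) (ho : ‖o‖ = 1)
    (ρ : ℝ) (hρ0 : 0 ≤ ρ) (hρ : ρ ≤ Real.pi / 2)
    (T : Set (EuclideanSpace ℝ (Fin (n + 1))))
    (hTH : T ⊆ {x | ‖x‖ = 1 ∧ geodist o x ≤ Real.pi / 2})
    (hstar : ∀ x ∈ T, ∀ a b : ℝ, 0 ≤ a → 0 ≤ b →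
      ‖a • o + b • x‖ = 1 → a • o + b • x ∈ T) :
    μH[(n : ℝ)] {x | ‖x‖ = 1 ∧ geodist o x ≤ ρ} * μH[(n : ℝ)] T ≤
      μH[(n : ℝ)] ({x | ‖x‖ = 1 ∧ geodist o x ≤ ρ} ∩ T) *
        μH[(n : ℝ)] {x | ‖x‖ = 1 ∧ geodist o x ≤ Real.pi / 2} := by
  have hpi := Real.pi_pos
  have eH : {x : EuclideanSpace ℝ (Fin (n + 1)) | ‖x‖ = 1 ∧ geodist o x ≤ Real.pi / 2} =
      {x | ‖x‖ = 1 ∧ 0 ≤ ⟪o, x⟫} := by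
    ext x
    exact and_congr Iff.rfl Real.arccos_le_pi_div_two
  have eB : {x : EuclideanSpace ℝ (Fin (n + 1)) | ‖x‖ = 1 ∧ geodist o x ≤ ρ} =
      {x | ‖x‖ = 1 ∧ Real.cos ρ ≤ ⟪o, x⟫} := by
    ext x
    refine and_congr_right fun hx => ?_
    have h1 : |⟪o, x⟫| ≤ 1 := by
      have := abs_real_inner_le_norm o x
      rwa [ho, hx, one_mul] at this
    rw [abs_le] at h1
    constructor
    · intro h
      rw [← Real.cos_arccos h1.1 h1.2]
      exact Real.cos_le_cos_of_nonneg_of_le_pi (Real.arccos_nonneg _) (by linarith) h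
    · intro h
      have := Real.antitone_arccos h
      rwa [Real.arccos_cos hρ0 (by linarith)] at this
  have hc : 0 ≤ Real.cos ρ := Real.cos_nonneg_of_neg_pi_div_two_le_of_le (by linarith) hρ
  rw [eH] at hTH ⊢
  rw [eB]
  set H : Set (EuclideanSpace ℝ (Fin (n + 1))) := {x | ‖x‖ = 1 ∧ 0 ≤ ⟪o, x⟫} with hH
  set B : Set (EuclideanSpace ℝ (Fin (n + 1))) := {x | ‖x‖ = 1 ∧ Real.cos ρ ≤ ⟪o, x⟫} with hB
  have hBH : B ⊆ H := fun x hx => ⟨hx.1, hc.trans hx.2⟩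
  by_cases hex : ∃ x : EuclideanSpace ℝ (Fin (n + 1)), x - ⟪o, x⟫ • o ≠ 0
  · obtain ⟨x, hx⟩ := hex
    have hoo : ⟪o, o⟫ = 1 := by rw [real_inner_self_eq_norm_sq, ho]; norm_num
    have hin : Measurable (fun x : EuclideanSpace ℝ (Fin (n + 1)) => ⟪o, x⟫) := by fun_prop
    have hHm : MeasurableSet H :=
      (measurableSet_eq_fun measurable_norm measurable_const).inter
        (measurableSet_le measurable_const hin)
    have : IsFiniteMeasure ((μH[(n : ℝ)]).restrict H) :=
      ⟨by rw [Measure.restrict_apply_univ]; exact sc_finite n o ho⟩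
    have key := sc_core o ho (‖x - ⟪o, x⟫ • o‖⁻¹ • (x - ⟪o, x⟫ • o))
      (by rw [norm_smul, norm_inv, norm_norm, inv_mul_cancel₀ (norm_ne_zero_iff.2 hx)])
      (by rw [inner_smul_right, inner_sub_right, inner_smul_right, hoo]; ring)
      ((μH[(n : ℝ)]).restrict H) (by
        intro u hu S hS
        rw [Measure.restrict_apply hS, Measure.restrict_apply (u.continuous.measurable hS)]
        have hpre : u ⁻¹' H = H := by
          ext y
          have : ⟪o, u y⟫ = ⟪o, y⟫ := by
            conv_lhs => rw [← hu]
            rw [LinearIsometryEquiv.inner_map_map]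
          simp [hH, this]
        conv_lhs => rw [← hpre, ← Set.preimage_inter]
        exact u.toIsometryEquiv.hausdorffMeasure_preimage _ _)
      (ae_restrict_mem hHm) (Real.cos ρ) hc T hTH hstar
    rw [Measure.restrict_apply_univ, Measure.restrict_eq_self _ hBH,
      Measure.restrict_eq_self _ hTH,
      Measure.restrict_eq_self _ (Set.inter_subset_left.trans hBH)] at key
    exact key
  · push Not at hex
    have hHo : ∀ x ∈ H, x = o := by
      rintro x ⟨h1, h2⟩
      have h3 := sub_eq_zero.1 (hex x)
      have : ⟪o, x⟫ = 1 := by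
        rw [h3, norm_smul, ho, mul_one, Real.norm_of_nonneg h2] at h1
        exact h1
      rw [h3, this, one_smul]
    have hTB : T ⊆ B := by
      intro x hx
      rw [hHo x (hTH hx)]
      refine ⟨ho, ?_⟩
      rw [real_inner_self_eq_norm_sq, ho]
      simpa using Real.cos_le_one ρ
    rw [Set.inter_eq_self_of_subset_right hTB, mul_comm]
    exact mul_le_mul' le_rfl (measure_mono hBH)
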